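/- arXiv:1303.5591 — 2 statements merged into one kernel-verified Lean document; each statement's English description precedes it below -/
import Mathlib

section
/- Fix ε ∈ [0, 1/2), and let c be the unique real number in (0,1) with H(c/2) = 1/2, where H is the binary entropy function. Set ε* = (2^{1/(2−c)} − 1)/(2·(2^{1/(2−c)} + 1)). For each r ≥ 1, let B_{2r} be the Bernoulli distribution with parameter 1/2+ε on {0,1}^{2r} and consider the quantity Q(r) = ‖B_{2r}‖_{2^{r+1}−1} / (2^{2r}·(1/2−ε)^{2r}). If ε < ε*, then Q(r) → 0 as r → ∞; if ε > ε*, then Q(r) → ∞ as r → ∞. -/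
open Finset

/-- Hamming weight of a binary string. -/
def hammingWeight {n : ℕ} (x : Fin n → Bool) : ℕ :=
  (Finset.univ.filter (fun j => x j = true)).card

/-- The Bernoulli distribution with parameter `p₊ = 1/2 + ε` on `{0,1}^n`:
`B(x) = (1/2+ε)^(n−w(x)) (1/2−ε)^(w(x))`. -/
noncomputable def bern (n : ℕ) (ε : ℝ) (x : Fin n → Bool) : ℝ :=
  (1/2 + ε) ^ (n - hammingWeight x) * (1/2 - ε) ^ (hammingWeight x)

/-- The `K`-th Ky Fan norm of `Q` : the sum of the `K` largest values of `Q`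
(with multiplicity), i.e. the maximal sum of `Q` over subsets of cardinality `K`. -/
noncomputable def kyFan {Z : Type*} [Fintype Z] (K : ℕ) (Q : Z → ℝ) : ℝ :=
  sSup ((fun S : Finset Z => ∑ z ∈ S, Q z) '' {S : Finset Z | S.card = K})

/-- The binary entropy function H(x) = −x·log₂ x − (1−x)·log₂(1−x). -/
noncomputable def binEnt (x : ℝ) : ℝ :=
  -x * Real.logb 2 x - (1 - x) * Real.logb 2 (1 - x)

/-- A function of the Hamming weight, summed over binary strings, as a binomial sum. -/
lemma sum_hammingWeight {M : Type*} [AddCommMonoid M] (n : ℕ) (f : ℕ → M) :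
    ∑ x : Fin n → Bool, f (hammingWeight x) = ∑ k ∈ range (n + 1), n.choose k • f k := by
  have h := Finset.sum_powerset_apply_card f (x := (univ : Finset (Fin n)))
  rw [powerset_univ, card_univ, Fintype.card_fin] at h
  rw [← h]
  refine Fintype.sum_bijective (fun x : Fin n → Bool => univ.filter fun j => x j = true) ?_ _ _
    fun _ => rfl
  refine Function.bijective_iff_has_inverse.mpr ⟨fun s j => decide (j ∈ s), fun x => ?_, fun s => ?_⟩
  · funext j
    simp
  · ext j
    simp

lemma hammingWeight_le {n : ℕ} (x : Fin n → Bool) : hammingWeight x ≤ n := by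
  simpa [hammingWeight] using card_le_univ (univ.filter fun j => x j = true)

lemma sum_pow_hammingWeight (n : ℕ) (y : ℝ) :
    ∑ x : Fin n → Bool, y ^ hammingWeight x = (y + 1) ^ n := by
  rw [sum_hammingWeight n (fun k => y ^ k), add_pow]
  refine sum_congr rfl fun k _ => ?_
  simp [mul_comm]

lemma sum_bernoulliWeight (n : ℕ) (b : ℝ) :
    ∑ x : Fin n → Bool, b ^ hammingWeight x * (1 - b) ^ (n - hammingWeight x) = 1 := by
  rw [sum_hammingWeight n (fun k => b ^ k * (1 - b) ^ (n - k))]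
  have h := congrArg (Polynomial.eval b) (bernsteinPolynomial.sum ℝ n)
  simpa [bernsteinPolynomial, Polynomial.eval_finsetSum, mul_assoc] using h

lemma sum_sq_mul_bernoulliWeight (n : ℕ) (b : ℝ) :
    ∑ x : Fin n → Bool, (n * b - hammingWeight x) ^ 2 *
      (b ^ hammingWeight x * (1 - b) ^ (n - hammingWeight x)) = n * b * (1 - b) := by
  rw [sum_hammingWeight n (fun k => (n * b - k) ^ 2 * (b ^ k * (1 - b) ^ (n - k)))]
  have h := congrArg (Polynomial.eval b) (bernsteinPolynomial.variance ℝ n)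
  simp only [bernsteinPolynomial, Polynomial.eval_finsetSum, Polynomial.eval_mul,
    Polynomial.eval_pow, Polynomial.eval_sub, Polynomial.eval_natCast, Polynomial.eval_X,
    Polynomial.eval_one, nsmul_eq_mul] at h ⊢
  rw [← h]
  refine sum_congr rfl fun k _ => ?_
  ring

lemma binEnt_eq_binEntropy_div (x : ℝ) : binEnt x = Real.binEntropy x / Real.log 2 := by
  simp only [binEnt, Real.binEntropy, Real.logb, Real.log_inv]
  ring

lemma binEntropy_eq_sub (b : ℝ) :
    Real.binEntropy b = b * (Real.log (1 - b) - Real.log b) - Real.log (1 - b) := by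
  simp only [Real.binEntropy, Real.log_inv]
  ring

/-- Entropy lower bound on the volume of a Hamming ball, from Chebyshev's inequality for the
binomial distribution. -/
lemma exp_binEntropy_le_card_ball {n : ℕ} {b δ : ℝ} (hb0 : 0 < b) (hb : b < 1 / 2) (hδ : 0 < δ)
    (hn : 2 ≤ δ ^ 2 * n) :
    Real.exp (n * (Real.binEntropy b - δ * (Real.log (1 - b) - Real.log b))) ≤
      2 * (univ.filter fun x : Fin n → Bool => (hammingWeight x : ℝ) ≤ (b + δ) * n).card := by
  set L := Real.log (1 - b) - Real.log b with hL
  have hLpos : 0 < L := sub_pos.mpr (Real.log_lt_log hb0 (by linarith))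
  have hnpos : (0 : ℝ) < n := by
    by_contra h
    nlinarith [sq_nonneg δ]
  set M := Real.exp (-(n * (Real.binEntropy b - δ * L))) with hM
  have hpt : ∀ x : Fin n → Bool,
      b ^ hammingWeight x * (1 - b) ^ (n - hammingWeight x) ≤
        (if (hammingWeight x : ℝ) ≤ (b + δ) * n then M else 0) +
        (n * b - hammingWeight x) ^ 2 *
          (b ^ hammingWeight x * (1 - b) ^ (n - hammingWeight x)) / (δ * n) ^ 2 := by
    intro x
    have hw := hammingWeight_le x
    have h1b : 0 < 1 - b := by linarith
    set w := hammingWeight x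
    have hfpos : 0 < b ^ w * (1 - b) ^ (n - w) := by positivity
    have hf : b ^ w * (1 - b) ^ (n - w) = Real.exp (n * Real.log (1 - b) - w * L) := by
      rw [← Real.exp_log (pow_pos hb0 w), ← Real.exp_log (pow_pos h1b (n - w)), ← Real.exp_add,
        Real.log_pow, Real.log_pow, Nat.cast_sub hw, hL]
      congr 1
      ring
    have hM0 : 0 < M := Real.exp_pos _
    by_cases hc : (δ * n) ^ 2 ≤ (n * b - w) ^ 2
    · have : b ^ w * (1 - b) ^ (n - w) ≤
          (n * b - w) ^ 2 * (b ^ w * (1 - b) ^ (n - w)) / (δ * n) ^ 2 := by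
        rw [le_div_iff₀ (by positivity), mul_comm]
        exact mul_le_mul_of_nonneg_right hc hfpos.le
      split_ifs <;> linarith
    · obtain ⟨h1, h2⟩ := abs_lt.mp (abs_lt_of_sq_lt_sq (not_le.mp hc) (by positivity))
      rw [if_pos (by nlinarith)]
      have : b ^ w * (1 - b) ^ (n - w) ≤ M := by
        rw [hf, hM, Real.exp_le_exp, binEntropy_eq_sub, ← hL]
        nlinarith
      have : 0 ≤ (n * b - w) ^ 2 * (b ^ w * (1 - b) ^ (n - w)) / (δ * n) ^ 2 := by positivity
      linarith
  have hsum := sum_le_sum fun x (_ : x ∈ (univ : Finset (Fin n → Bool))) => hpt x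
  rw [sum_bernoulliWeight, sum_add_distrib, ← sum_div, sum_sq_mul_bernoulliWeight, ← sum_filter, sum_const,
    nsmul_eq_mul] at hsum
  have htail : n * b * (1 - b) / (δ * n) ^ 2 ≤ 1 / 2 := by
    rw [div_le_iff₀ (by positivity)]
    nlinarith [mul_le_mul_of_nonneg_right hn hnpos.le, mul_pos hnpos hb0]
  have hexp : Real.exp (n * (Real.binEntropy b - δ * L)) * M = 1 := by
    rw [hM, ← Real.exp_add, add_neg_cancel, Real.exp_zero]
  refine le_of_mul_le_mul_right ?_ (Real.exp_pos _ : 0 < M)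
  rw [hexp]
  linarith

lemma bern_eq_exp {n : ℕ} {ε : ℝ} (hε : |ε| < 1 / 2) (x : Fin n → Bool) :
    bern n ε x = (1 / 2 - ε) ^ n *
      Real.exp ((Real.log (1 / 2 + ε) - Real.log (1 / 2 - ε)) * (n - hammingWeight x)) := by
  obtain ⟨h1, h2⟩ := abs_lt.mp hε
  have hp : 0 < 1 / 2 + ε := by linarith
  have hq : 0 < 1 / 2 - ε := by linarith
  obtain ⟨k, hk⟩ := Nat.exists_eq_add_of_le (hammingWeight_le x)
  have hk' : (n : ℝ) - hammingWeight x = k := by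
    rw [sub_eq_iff_eq_add']
    exact_mod_cast hk
  rw [bern, hk', mul_comm _ (k : ℝ), Real.exp_nat_mul, Real.exp_sub, Real.exp_log hp,
    Real.exp_log hq, show n - hammingWeight x = k by omega]
  conv_rhs => rw [hk]
  rw [pow_add, div_pow, mul_assoc, mul_div_cancel₀ _ (pow_pos hq k).ne', mul_comm]

/-- Entropy upper bound on the weight of any `K` strings under an exponential weighting. -/
lemma sum_exp_le {n : ℕ} {a L : ℝ} (ha0 : 0 < a) (ha : a < 1) (hL : 0 ≤ L)
    (hLa : L ≤ Real.log (1 - a) - Real.log a) (S : Finset (Fin n → Bool)) :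
    ∑ x ∈ S, Real.exp (L * (n - hammingWeight x)) ≤
      Real.exp (L * ((1 - a) * n)) * (S.card + Real.exp (n * Real.binEntropy a)) := by
  set T := Real.log (1 - a) - Real.log a with hT
  have hpt : ∀ x : Fin n → Bool, Real.exp (L * (n - hammingWeight x)) ≤
      Real.exp (L * ((1 - a) * n)) * (1 + Real.exp (T * (a * n - hammingWeight x))) := by
    intro x
    rw [show L * (n - hammingWeight x) = L * ((1 - a) * n) + L * (a * n - hammingWeight x) by ring,
      Real.exp_add]
    refine mul_le_mul_of_nonneg_left ?_ (Real.exp_pos _).le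
    rcases le_total 0 (a * n - hammingWeight x) with h | h
    · have := Real.exp_le_exp.mpr (mul_le_mul_of_nonneg_right hLa h)
      linarith
    · have := Real.exp_le_one_iff.mpr (mul_nonpos_of_nonneg_of_nonpos hL h)
      linarith [Real.exp_pos (T * (a * n - hammingWeight x))]
  have hball : ∑ x : Fin n → Bool, Real.exp (T * (a * n - hammingWeight x)) =
      Real.exp (n * Real.binEntropy a) := by
    have h1a : 0 < 1 - a := by linarith
    have hy : Real.exp (-T) + 1 = Real.exp (-Real.log (1 - a)) := by
      rw [hT, neg_sub, Real.exp_sub, Real.exp_neg, Real.exp_log ha0, Real.exp_log h1a]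
      field_simp
      ring
    calc _ = Real.exp (n * (T * a)) * ∑ x : Fin n → Bool, Real.exp (-T) ^ hammingWeight x := by
          rw [mul_sum]
          refine sum_congr rfl fun x _ => ?_
          rw [← Real.exp_nat_mul, ← Real.exp_add]
          congr 1
          ring
      _ = _ := by
          rw [sum_pow_hammingWeight, hy, ← Real.exp_nat_mul, ← Real.exp_add, binEntropy_eq_sub,
            ← hT]
          congr 1
          ring
  calc _ ≤ ∑ x ∈ S, Real.exp (L * ((1 - a) * n)) *
        (1 + Real.exp (T * (a * n - hammingWeight x))) := sum_le_sum fun x _ => hpt x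
    _ ≤ _ := by
        rw [← mul_sum, sum_add_distrib, ← hball]
        refine mul_le_mul_of_nonneg_left ?_ (Real.exp_pos _).le
        refine add_le_add (by simp) ?_
        exact sum_le_sum_of_subset_of_nonneg (subset_univ S) fun _ _ _ => (Real.exp_pos _).le

lemma sum_le_kyFan {Z : Type*} [Fintype Z] (Q : Z → ℝ) (S : Finset Z) :
    ∑ z ∈ S, Q z ≤ kyFan S.card Q :=
  le_csSup (Set.toFinite _).bddAbove ⟨S, rfl, rfl⟩

lemma kyFan_bern_div_le {a ε : ℝ} (ha0 : 0 < a) (ha : a < 1)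
    (hH : Real.binEntropy a = Real.log 2 / 2) (hε0 : 0 ≤ ε) (hε : ε < 1 / 2)
    (hLa : Real.log (1 / 2 + ε) - Real.log (1 / 2 - ε) ≤ Real.log (1 - a) - Real.log a) (r : ℕ) :
    kyFan (2 ^ (r + 1) - 1) (bern (2 * r) ε) / ((2 : ℝ) ^ (2 * r) * (1 / 2 - ε) ^ (2 * r)) ≤
      3 * Real.exp (r * (2 * (1 - a) * (Real.log (1 / 2 + ε) - Real.log (1 / 2 - ε)) -
        Real.log 2)) := by
  have hq : 0 < 1 / 2 - ε := by linarith
  have hL0 : 0 ≤ Real.log (1 / 2 + ε) - Real.log (1 / 2 - ε) :=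
    sub_nonneg.mpr (Real.log_le_log hq (by linarith))
  have hε' : |ε| < 1 / 2 := by rwa [abs_of_nonneg hε0]
  set L := Real.log (1 / 2 + ε) - Real.log (1 / 2 - ε) with hL
  rw [div_le_iff₀ (by positivity)]
  refine Real.sSup_le ?_ (by positivity)
  rintro _ ⟨S, hS, rfl⟩
  have hS' : (S.card : ℝ) ≤ 2 * 2 ^ r := by
    rw [← pow_succ']
    exact_mod_cast (show S.card = _ from hS).le.trans (Nat.sub_le _ _)
  have hpow : Real.exp ((2 * r : ℕ) * Real.binEntropy a) = 2 ^ r := by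
    rw [hH, ← Real.exp_log (pow_pos (two_pos : (0 : ℝ) < 2) r), Real.log_pow]
    congr 1
    push_cast
    ring
  have hexp : Real.exp (r * (2 * (1 - a) * L - Real.log 2)) * 2 ^ r =
      Real.exp (L * ((1 - a) * (2 * r : ℕ))) := by
    have hlog : ((2 : ℝ) ^ r) = Real.exp (r * Real.log 2) := by
      rw [← Real.log_pow, Real.exp_log (by positivity)]
    rw [hlog, ← Real.exp_add]
    congr 1
    push_cast
    ring
  calc ∑ x ∈ S, bern (2 * r) ε x
      = (1 / 2 - ε) ^ (2 * r) *
          ∑ x ∈ S, Real.exp (L * ((2 * r : ℕ) - hammingWeight x)) := by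
        rw [mul_sum]
        exact sum_congr rfl fun x _ => bern_eq_exp hε' x
    _ ≤ (1 / 2 - ε) ^ (2 * r) *
          (Real.exp (L * ((1 - a) * (2 * r : ℕ))) * (2 * 2 ^ r + 2 ^ r)) := by
        refine mul_le_mul_of_nonneg_left ((sum_exp_le ha0 ha hL0 hLa S).trans ?_) (by positivity)
        rw [hpow]
        gcongr
    _ = _ := by
        rw [← hexp]
        ring

lemma tendsto_exp_natCast_mul_atTop {η : ℝ} (hη : 0 < η) :
    Filter.Tendsto (fun r : ℕ => Real.exp (r * η)) Filter.atTop Filter.atTop :=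
  Real.tendsto_exp_atTop.comp (tendsto_natCast_atTop_atTop.atTop_mul_const hη)

lemma tendsto_kyFan_bern_div_atTop {a β ε : ℝ} (ha0 : 0 < a) (haβ : a < β) (hβ : β < 1 / 2)
    (hH : Real.binEntropy a = Real.log 2 / 2) (hε0 : 0 ≤ ε) (hε : ε < 1 / 2)
    (hβε : Real.log 2 < 2 * (1 - β) * (Real.log (1 / 2 + ε) - Real.log (1 / 2 - ε))) :
    Filter.Tendsto
      (fun r : ℕ => kyFan (2 ^ (r + 1) - 1) (bern (2 * r) ε) /
        ((2 : ℝ) ^ (2 * r) * (1 / 2 - ε) ^ (2 * r))) Filter.atTop Filter.atTop := by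
  have hq : 0 < 1 / 2 - ε := by linarith
  have hL0 : 0 ≤ Real.log (1 / 2 + ε) - Real.log (1 / 2 - ε) :=
    sub_nonneg.mpr (Real.log_le_log hq (by linarith))
  have hε' : |ε| < 1 / 2 := by rwa [abs_of_nonneg hε0]
  set L := Real.log (1 / 2 + ε) - Real.log (1 / 2 - ε) with hL
  obtain ⟨b, hab, hbβ⟩ := exists_between haβ
  have hb0 : 0 < b := ha0.trans hab
  have hent : Real.binEntropy a < Real.binEntropy b :=
    Real.binEntropy_strictMonoOn ⟨ha0.le, by linarith⟩ ⟨hb0.le, by linarith⟩ hab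
  have hΛ : 0 < Real.log (1 - b) - Real.log b :=
    sub_pos.mpr (Real.log_lt_log hb0 (by linarith))
  set Λ := Real.log (1 - b) - Real.log b with hΛdef
  obtain ⟨δ, hδ0, hδ⟩ := exists_between
    (lt_min (sub_pos.mpr hbβ) (div_pos (sub_pos.mpr hent) hΛ))
  obtain ⟨hδβ, hδΛ⟩ := lt_min_iff.mp hδ
  rw [lt_div_iff₀ hΛ] at hδΛ
  set η := Real.binEntropy b - δ * Λ - Real.binEntropy a with hη
  have hη0 : 0 < 2 * η := by linarith
  refine Filter.tendsto_atTop_mono' _ ?_ (tendsto_exp_natCast_mul_atTop (sub_pos.mpr hβε))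
  filter_upwards [(tendsto_exp_natCast_mul_atTop hη0).eventually_ge_atTop 4,
    (tendsto_natCast_atTop_atTop (R := ℝ)).eventually_ge_atTop (1 / δ ^ 2)] with r hr4 hrδ
  have hlog : ((2 : ℝ) ^ r) = Real.exp (r * Real.log 2) := by
    rw [← Real.log_pow, Real.exp_log (by positivity)]
  have hball := exp_binEntropy_le_card_ball (n := 2 * r) hb0 (by linarith) hδ0 (by
    rw [div_le_iff₀ (by positivity)] at hrδ
    push_cast
    linarith)
  rw [← hΛdef] at hball
  set A := univ.filter fun x : Fin (2 * r) → Bool =>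
    (hammingWeight x : ℝ) ≤ (b + δ) * (2 * r : ℕ) with hA
  have hsplit : Real.exp ((2 * r : ℕ) * (Real.binEntropy b - δ * Λ)) =
      2 ^ r * Real.exp (r * (2 * η)) := by
    rw [hlog, ← Real.exp_add, hη, hH]
    congr 1
    push_cast
    ring
  have hcard : 2 ^ (r + 1) - 1 ≤ A.card := by
    refine (Nat.sub_le _ _).trans ?_
    have : (2 : ℝ) ^ (r + 1) ≤ A.card := by
      rw [hsplit] at hball
      have := mul_le_mul_of_nonneg_left hr4 (by positivity : (0 : ℝ) ≤ 2 ^ r)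
      rw [pow_succ]
      linarith
    exact_mod_cast this
  obtain ⟨S, hSA, hS⟩ := exists_subset_card_eq hcard
  have hS' : (2 : ℝ) ^ r ≤ S.card := by
    have : 2 ^ r ≤ S.card := by
      rw [hS, pow_succ]
      have := Nat.one_le_two_pow (n := r)
      omega
    exact_mod_cast this
  rw [le_div_iff₀ (by positivity)]
  refine le_trans ?_ (hS ▸ sum_le_kyFan (bern (2 * r) ε) S)
  have hpt : ∀ x ∈ S, (1 / 2 - ε) ^ (2 * r) * Real.exp (L * ((1 - β) * (2 * r))) ≤
      bern (2 * r) ε x := by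
    intro x hx
    have hxw := (mem_filter.mp (hSA hx)).2
    rw [bern_eq_exp hε' x, ← hL]
    refine mul_le_mul_of_nonneg_left (Real.exp_le_exp.mpr ?_) (by positivity)
    refine mul_le_mul_of_nonneg_left ?_ hL0
    push_cast at hxw ⊢
    nlinarith [mul_nonneg (sub_nonneg.mpr (by linarith : b + δ ≤ β)) (Nat.cast_nonneg (α := ℝ) r)]
  refine le_trans (le_of_eq ?_) ((mul_le_mul_of_nonneg_right hS' (by positivity)).trans
    ((nsmul_eq_mul _ _).symm.le.trans (card_nsmul_le_sum S _ _ hpt)))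
  have hexp : Real.exp (r * (2 * (1 - β) * L - Real.log 2)) * 2 ^ r =
      Real.exp (L * ((1 - β) * (2 * r))) := by
    rw [hlog, ← Real.exp_add]
    congr 1
    ring
  rw [← hexp]
  ring

/-- The threshold on `ε` in terms of the log-likelihood ratio `log ((1/2 + ε) / (1/2 - ε))`. -/
lemma log_ratio_lt_iff {ε t : ℝ} (hε0 : 0 ≤ ε) (hε : ε < 1 / 2) :
    Real.log (1 / 2 + ε) - Real.log (1 / 2 - ε) < t * Real.log 2 ↔
      ε < ((2 : ℝ) ^ t - 1) / (2 * ((2 : ℝ) ^ t + 1)) := by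
  have hq : 0 < 1 / 2 - ε := by linarith
  have hp : 0 < 1 / 2 + ε := by linarith
  have ht : 0 < (2 : ℝ) ^ t := by positivity
  rw [← Real.log_div hp.ne' hq.ne', ← Real.log_rpow two_pos,
    Real.log_lt_log_iff (by positivity) ht, div_lt_iff₀ hq, lt_div_iff₀ (by positivity)]
  constructor <;> intro h <;> nlinarith

lemma lt_log_ratio_iff {ε t : ℝ} (hε0 : 0 ≤ ε) (hε : ε < 1 / 2) :
    t * Real.log 2 < Real.log (1 / 2 + ε) - Real.log (1 / 2 - ε) ↔
      ((2 : ℝ) ^ t - 1) / (2 * ((2 : ℝ) ^ t + 1)) < ε := by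
  have hq : 0 < 1 / 2 - ε := by linarith
  have hp : 0 < 1 / 2 + ε := by linarith
  have ht : 0 < (2 : ℝ) ^ t := by positivity
  rw [← Real.log_div hp.ne' hq.ne', ← Real.log_rpow two_pos,
    Real.log_lt_log_iff ht (by positivity), lt_div_iff₀ hq, div_lt_iff₀ (by positivity)]
  constructor <;> intro h <;> nlinarith

lemma lt_one_third_of_binEntropy_eq {a : ℝ} (ha : a < 1 / 2)
    (hH : Real.binEntropy a = Real.log 2 / 2) : a < 1 / 3 := by
  by_contra! h
  have hmono : Real.binEntropy (1 / 3) ≤ Real.binEntropy a :=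
    Real.binEntropy_strictMonoOn.monotoneOn ⟨by norm_num, by norm_num⟩
      ⟨by linarith, by linarith⟩ h
  have h3 : Real.binEntropy (1 / 3) = Real.log 3 - 2 / 3 * Real.log 2 := by
    rw [Real.binEntropy, show (1 / 3 : ℝ)⁻¹ = 3 by norm_num,
      show (1 - 1 / 3 : ℝ)⁻¹ = 3 / 2 by norm_num, Real.log_div (by norm_num) (by norm_num)]
    ring
  have h23 : 7 * Real.log 2 < 6 * Real.log 3 := by
    have := Real.log_lt_log (by norm_num) (show (2 : ℝ) ^ 7 < 3 ^ 6 by norm_num)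
    rwa [Real.log_pow, Real.log_pow] at this
  linarith

/-- with c ∈ (0,1) defined by H(c/2) = 1/2 and
ε* = (2^{1/(2−c)} − 1)/(2(2^{1/(2−c)} + 1)), the ratio
Q(r) = ‖B_{2r}‖_{2^{r+1}−1} / (2^{2r}(1/2−ε)^{2r}) tends to 0 when ε < ε*
and to ∞ when ε > ε*. -/
theorem chained_bell_exact_threshold
    (c ε : ℝ) (hc : c ∈ Set.Ioo (0 : ℝ) 1) (hcH : binEnt (c / 2) = 1/2)
    (hε0 : 0 ≤ ε) (hε : ε < 1/2) :
    (ε < ((2 : ℝ) ^ (1 / (2 - c)) - 1) / (2 * ((2 : ℝ) ^ (1 / (2 - c)) + 1)) →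
      Filter.Tendsto
        (fun r : ℕ => kyFan (2 ^ (r + 1) - 1) (bern (2 * r) ε) /
          ((2 : ℝ) ^ (2 * r) * (1/2 - ε) ^ (2 * r)))
        Filter.atTop (nhds 0)) ∧
    (((2 : ℝ) ^ (1 / (2 - c)) - 1) / (2 * ((2 : ℝ) ^ (1 / (2 - c)) + 1)) < ε →
      Filter.Tendsto
        (fun r : ℕ => kyFan (2 ^ (r + 1) - 1) (bern (2 * r) ε) /
          ((2 : ℝ) ^ (2 * r) * (1/2 - ε) ^ (2 * r)))
        Filter.atTop Filter.atTop) := by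
  obtain ⟨hc0, hc1⟩ := hc
  have hlog2 : 0 < Real.log 2 := Real.log_pos one_lt_two
  have hH : Real.binEntropy (c / 2) = Real.log 2 / 2 := by
    rw [binEnt_eq_binEntropy_div, div_eq_iff hlog2.ne'] at hcH
    linarith
  have ha0 : 0 < c / 2 := by linarith
  have ha : c / 2 < 1 / 2 := by linarith
  have h2c : 0 < 2 - c := by linarith
  constructor
  · intro h
    rw [← log_ratio_lt_iff hε0 hε, one_div_mul_eq_div, lt_div_iff₀ h2c] at h
    have ha3 := lt_one_third_of_binEntropy_eq ha hH
    have hL0 : 0 ≤ Real.log (1 / 2 + ε) - Real.log (1 / 2 - ε) :=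
      sub_nonneg.mpr (Real.log_le_log (by linarith) (by linarith))
    have hLa : Real.log (1 / 2 + ε) - Real.log (1 / 2 - ε) ≤
        Real.log (1 - c / 2) - Real.log (c / 2) := by
      have hdiv : Real.log 2 ≤ Real.log (1 - c / 2) - Real.log (c / 2) := by
        rw [← Real.log_div (by linarith) (by linarith)]
        refine Real.log_le_log two_pos ?_
        rw [le_div_iff₀ ha0]
        linarith
      nlinarith
    refine squeeze_zero (fun r => ?_)
      (kyFan_bern_div_le ha0 (by linarith) hH hε0 hε hLa) ?_
    · have hq : 0 < 1 / 2 - ε := by linarith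
      refine div_nonneg (Real.sSup_nonneg ?_) (by positivity)
      rintro _ ⟨S, -, rfl⟩
      refine sum_nonneg fun x _ => ?_
      rw [bern]
      positivity
    · rw [← mul_zero (3 : ℝ)]
      refine (Real.tendsto_exp_atBot.comp
        (tendsto_natCast_atTop_atTop.atTop_mul_const_of_neg ?_)).const_mul 3
      linarith
  · intro h
    rw [← lt_log_ratio_iff hε0 hε, one_div_mul_eq_div, div_lt_iff₀ h2c] at h
    set L := Real.log (1 / 2 + ε) - Real.log (1 / 2 - ε) with hL
    have hL0 : 0 < L := by
      by_contra! hneg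
      nlinarith
    have hgap : c / 2 < 1 - Real.log 2 / (2 * L) := by
      rw [lt_sub_comm, div_lt_iff₀ (by positivity)]
      linarith
    obtain ⟨β, haβ, hβ⟩ := exists_between (lt_min ha hgap)
    obtain ⟨hβ1, hβ2⟩ := lt_min_iff.mp hβ
    refine tendsto_kyFan_bern_div_atTop ha0 haβ hβ1 hH hε0 hε ?_
    rw [lt_sub_comm, div_lt_iff₀ (by positivity)] at hβ2
    linarith
end

section
/- Let c be the unique real number in (0,1) with H(c/2) = 1/2, where H is the binary entropy function, and set ε* = (2^{1/(2−c)} − 1)/(2·(2^{1/(2−c)} + 1)). Fix ε with ε* < ε < 1/2, write p₊ = 1/2+ε and p₋ = 1/2−ε, and for each r ≥ 1 let B_{2r} be the Bernoulli distribution with parameter p₊ on {0,1}^{2r}. Then the sequence r ↦ sin²(π/2^{r+2}) · (p₋^{2r} + ‖B_{2r}‖_{2^{r+1}−1}) / (2·p₋^{2r}) tends to ∞ as r → ∞; in particular, there exists r₀ such that for all r ≥ r₀ this quantity exceeds ε, so the protocol's output bias ε_new exceeds the input bias ε and no randomness amplification is possible. -/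
open Finset

/-- The Ky Fan norm is bounded below by any collection of values that are at least `v`. -/
lemma min_card_mul_le_kyFan {Z : Type*} [Fintype Z] {K : ℕ} {Q : Z → ℝ} {v a : ℝ} {T : Finset Z}
    (hK : K ≤ Fintype.card Z) (hQ : ∀ z, 0 ≤ Q z) (hv : 0 ≤ v) (hT : ∀ z ∈ T, v ≤ Q z)
    (haT : a ≤ T.card) (haK : a ≤ K) : a * v ≤ kyFan K Q := by
  classical
  obtain ⟨T', hT'T, hT'⟩ := Finset.exists_subset_card_eq (min_le_left T.card K)
  obtain ⟨S, hT'S, hS⟩ := Finset.exists_superset_card_eq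
    (hT'.trans_le (min_le_right T.card K)) hK
  have ha : a ≤ (T'.card : ℝ) := by
    rw [hT', Nat.cast_min]
    exact le_min haT haK
  calc a * v ≤ T'.card * v := by gcongr
    _ = ∑ _z ∈ T', v := by simp
    _ ≤ ∑ z ∈ T', Q z := Finset.sum_le_sum fun z hz => hT z (hT'T hz)
    _ ≤ ∑ z ∈ S, Q z := Finset.sum_le_sum_of_subset_of_nonneg hT'S fun z _ _ => hQ z
    _ ≤ kyFan K Q := le_csSup (Set.toFinite _).bddAbove ⟨S, hS, rfl⟩

lemma exists_card_eq_choose_hammingWeight (n k : ℕ) :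
    ∃ T : Finset (Fin n → Bool), T.card = n.choose k ∧ ∀ x ∈ T, hammingWeight x = k := by
  classical
  refine ⟨(Finset.powersetCard k Finset.univ).image fun s j => decide (j ∈ s), ?_, ?_⟩
  · rw [Finset.card_image_of_injective, Finset.card_powersetCard, Finset.card_univ,
      Fintype.card_fin]
    intro s t h
    ext j
    simpa using congrFun h j
  · intro x hx
    obtain ⟨s, hs, rfl⟩ := Finset.mem_image.1 hx
    simpa [hammingWeight] using (Finset.mem_powersetCard.1 hs).2

/-- The mode of the binomial distribution lies within distance one of its mean and carries
at least the average mass. -/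
lemma exists_binomial_mode (n : ℕ) {p : ℝ} (hp0 : 0 < p) (hp1 : p < 1) :
    ∃ k ≤ n, n * p + p - 1 ≤ k ∧ (k : ℝ) ≤ (n + 1) * p ∧
      1 ≤ (n + 1) * (n.choose k * (p ^ k * (1 - p) ^ (n - k))) := by
  have hq : 0 < 1 - p := by linarith
  let f : ℕ → ℝ := fun k => n.choose k * (p ^ k * (1 - p) ^ (n - k))
  obtain ⟨k, hk, hmax⟩ := Finset.exists_max_image (Finset.range (n + 1)) f ⟨0, by simp⟩
  have hkn : k ≤ n := Nat.lt_succ_iff.1 (Finset.mem_range.1 hk)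
  refine ⟨k, hkn, ?_, ?_, ?_⟩
  · rcases hkn.eq_or_lt with rfl | hlt
    · nlinarith [(Nat.cast_nonneg k : (0 : ℝ) ≤ k)]
    · have h := hmax (k + 1) (by simp; omega)
      obtain ⟨m, rfl⟩ : ∃ m, n = k + 1 + m := ⟨n - (k + 1), by omega⟩
      have e : (((k + 1 + m).choose (k + 1) : ℕ) : ℝ) * (k + 1)
          = (k + 1 + m).choose k * (m + 1) := by
        have := Nat.choose_succ_right_eq (k + 1 + m) k
        rw [show k + 1 + m - k = m + 1 by omega] at this
        exact_mod_cast this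
      have hC : (0 : ℝ) < (k + 1 + m).choose k := by exact_mod_cast Nat.choose_pos (by omega)
      have hw : 0 < p ^ k * (1 - p) ^ m := by positivity
      simp only [f, show k + 1 + m - (k + 1) = m by omega,
        show k + 1 + m - k = m + 1 by omega] at h
      have h' : ((k + 1 + m).choose (k + 1) : ℝ) * p ≤ (k + 1 + m).choose k * (1 - p) := by
        refine le_of_mul_le_mul_right ?_ hw
        calc _ = ((k + 1 + m).choose (k + 1) : ℝ) * (p ^ (k + 1) * (1 - p) ^ m) := by ring
          _ ≤ _ := h
          _ = _ := by ring
      have h2 : ((m : ℝ) + 1) * p ≤ (k + 1) * (1 - p) := by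
        refine le_of_mul_le_mul_left ?_ hC
        calc _ = (((k + 1 + m).choose (k + 1) : ℕ) : ℝ) * p * (k + 1) := by
              rw [← mul_assoc, ← e]; ring
          _ ≤ (k + 1 + m).choose k * (1 - p) * (k + 1) := by gcongr
          _ = _ := by ring
      push_cast
      linarith
  · rcases k with _ | k
    · simp; positivity
    · have h := hmax k (by simp; omega)
      obtain ⟨m, rfl⟩ : ∃ m, n = k + 1 + m := ⟨n - (k + 1), by omega⟩
      have e : (((k + 1 + m).choose (k + 1) : ℕ) : ℝ) * (k + 1)
          = (k + 1 + m).choose k * (m + 1) := by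
        have := Nat.choose_succ_right_eq (k + 1 + m) k
        rw [show k + 1 + m - k = m + 1 by omega] at this
        exact_mod_cast this
      have hC : (0 : ℝ) < (k + 1 + m).choose k := by exact_mod_cast Nat.choose_pos (by omega)
      have hw : 0 < p ^ k * (1 - p) ^ m := by positivity
      simp only [f, show k + 1 + m - (k + 1) = m by omega,
        show k + 1 + m - k = m + 1 by omega] at h
      have h' : ((k + 1 + m).choose k : ℝ) * (1 - p) ≤ (k + 1 + m).choose (k + 1) * p := by
        refine le_of_mul_le_mul_right ?_ hw
        calc _ = ((k + 1 + m).choose k : ℝ) * (p ^ k * (1 - p) ^ (m + 1)) := by ring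
          _ ≤ _ := h
          _ = _ := by ring
      have h2 : ((k : ℝ) + 1) * (1 - p) ≤ (m + 1) * p := by
        refine le_of_mul_le_mul_left ?_ hC
        calc _ = ((k + 1 + m).choose k : ℝ) * (1 - p) * (k + 1) := by ring
          _ ≤ (k + 1 + m).choose (k + 1) * p * (k + 1) := by gcongr
          _ = _ := by rw [← mul_assoc, ← e]; ring
      push_cast
      linarith
  · have hsum : ∑ m ∈ Finset.range (n + 1), f m = 1 := by
      have := add_pow p (1 - p) n
      rw [add_sub_cancel, one_pow] at this
      rw [this]
      exact Finset.sum_congr rfl fun m _ => by simp only [f]; ring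
    have := Finset.sum_le_card_nsmul _ f (f k) hmax
    rw [hsum, Finset.card_range, nsmul_eq_mul] at this
    exact_mod_cast this

/-- The weight of a string close to the mean is, up to a constant, at most the typical one. -/
lemma pow_mul_pow_le_of_binEnt_eq_half {p : ℝ} (hp0 : 0 < p) (hp2 : p ≤ 1 / 2)
    (hH : binEnt p = 1 / 2) {r k : ℕ} (hk : k ≤ 2 * r) (hkp : (2 * r : ℝ) * p - 1 ≤ k) :
    p ^ k * (1 - p) ^ (2 * r - k) ≤ (1 - p) / p / 2 ^ r := by
  have hq : 0 < 1 - p := by linarith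
  have hlog : Real.log p ≤ Real.log (1 - p) := Real.log_le_log hp0 (by linarith)
  have hent : p * Real.log p + (1 - p) * Real.log (1 - p) = -(Real.log 2 / 2) := by
    have h2 : Real.log 2 ≠ 0 := (Real.log_pos one_lt_two).ne'
    unfold binEnt Real.logb at hH
    field_simp at hH
    linarith
  rw [← Real.log_le_log_iff (by positivity) (by positivity), Real.log_mul (by positivity)
    (by positivity), Real.log_div (by positivity) (by positivity), Real.log_div hq.ne' hp0.ne',
    Real.log_pow, Real.log_pow, Real.log_pow, Nat.cast_sub hk]
  push_cast
  have h1 : 0 ≤ (k - (2 * r : ℝ) * p + 1) * (Real.log (1 - p) - Real.log p) :=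
    mul_nonneg (by linarith) (by linarith)
  linear_combination h1 + (2 * r : ℝ) * hent

lemma tendsto_pow_div_linear_atTop {a C : ℝ} (ha : 1 < a) (hC : 0 < C) :
    Filter.Tendsto (fun r : ℕ => C * (a ^ r / (2 * r + 1))) Filter.atTop Filter.atTop := by
  refine Filter.Tendsto.const_mul_atTop hC ?_
  have h1 := tendsto_pow_const_div_const_pow_of_one_lt 1 ha
  have h0 := tendsto_pow_const_div_const_pow_of_one_lt 0 ha
  have h : Filter.Tendsto (fun r : ℕ => (2 * (r : ℝ) + 1) / a ^ r) Filter.atTop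
      (nhdsWithin 0 (Set.Ioi 0)) := by
    refine tendsto_nhdsWithin_iff.2 ⟨?_, Filter.Eventually.of_forall fun r => ?_⟩
    · have := (h1.const_mul 2).add h0
      simp only [mul_zero, add_zero] at this
      refine this.congr fun r => ?_
      ring
    · have : 0 < a := by linarith
      simp only [Set.mem_Ioi]
      positivity
  refine h.inv_tendsto_nhdsGT_zero.congr fun r => ?_
  simp

/-- The odds at bias `(t - 1) / (2 (t + 1))` are exactly `t`. -/
lemma lt_odds_of_lt {t ε : ℝ} (ht : 0 < t) (h : (t - 1) / (2 * (t + 1)) < ε) (hε : ε < 1 / 2) :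
    t < (1 / 2 + ε) / (1 / 2 - ε) := by
  rw [div_lt_iff₀ (by positivity)] at h
  rw [lt_div_iff₀ (by linarith)]
  linarith

lemma bern_nonneg (n : ℕ) {ε : ℝ} (h₁ : 0 ≤ 1 / 2 + ε) (h₂ : 0 ≤ 1 / 2 - ε)
    (x : Fin n → Bool) : 0 ≤ bern n ε x :=
  mul_nonneg (pow_nonneg h₁ _) (pow_nonneg h₂ _)

lemma two_pow_succ_sub_one_le (r : ℕ) : 2 ^ (r + 1) - 1 ≤ 2 ^ (2 * r) := by
  rcases r with _ | r
  · simp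
  · exact (Nat.sub_le _ _).trans (Nat.pow_le_pow_right two_pos (by omega))

/-- The Ky Fan norm is at least, up to polynomial factors, the number `2 ^ r` of typical strings
for the parameter `p` of entropy one half, times their Bernoulli weight. -/
lemma le_kyFan_bern {p ε : ℝ} (hp0 : 0 < p) (hp2 : p ≤ 1 / 2) (hH : binEnt p = 1 / 2)
    (hε0 : 0 ≤ ε) (hε : ε < 1 / 2) (r : ℕ) :
    p / (1 - p) * 2 ^ r / (2 * r + 1) * ((1 / 2 - ε) ^ (2 * r) *
      ((((1 / 2 + ε) / (1 / 2 - ε)) ^ (2 * (1 - p))) ^ r / ((1 / 2 + ε) / (1 / 2 - ε))))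
      ≤ kyFan (2 ^ (r + 1) - 1) (bern (2 * r) ε) := by
  have hq : 0 < 1 - p := by linarith
  have hm : 0 < 1 / 2 - ε := by linarith
  have hpl : 0 < 1 / 2 + ε := by linarith
  obtain ⟨k, hkn, hlow, hup, hmode⟩ := exists_binomial_mode (2 * r) hp0 (by linarith)
  push_cast at hlow hup hmode
  obtain ⟨T, hTc, hT⟩ := exists_card_eq_choose_hammingWeight (2 * r) k
  have htyp := pow_mul_pow_le_of_binEnt_eq_half hp0 hp2 hH hkn (by linarith)
  refine min_card_mul_le_kyFan (T := T) ?_ (bern_nonneg _ hpl.le hm.le) (by positivity) ?_ ?_ ?_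
  · simpa using two_pow_succ_sub_one_le r
  · intro x hx
    rw [bern, hT x hx]
    set q := (1 / 2 + ε) / (1 / 2 - ε) with hqdef
    have hq1 : 1 ≤ q := by rw [hqdef, le_div_iff₀ hm]; linarith
    have hq0 : 0 < q := by linarith
    have hpq : 1 / 2 + ε = q * (1 / 2 - ε) :=
      (div_mul_cancel₀ _ hm.ne').symm
    have hpow : (1 / 2 + ε) ^ (2 * r - k) * (1 / 2 - ε) ^ k
        = (1 / 2 - ε) ^ (2 * r) * q ^ (2 * r - k) := by
      rw [hpq, mul_pow, mul_assoc, ← pow_add, Nat.sub_add_cancel hkn, mul_comm]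
    rw [hpow]
    gcongr
    rw [← Real.rpow_natCast, ← Real.rpow_natCast, ← Real.rpow_mul hq0.le, Nat.cast_sub hkn]
    nth_rewrite 2 [← Real.rpow_one q]
    rw [← Real.rpow_sub hq0]
    refine Real.rpow_le_rpow_of_exponent_le hq1 ?_
    push_cast
    linarith
  · rw [hTc, div_le_iff₀ (by positivity)]
    have h : 1 ≤ (2 * r + 1 : ℝ) * ((2 * r).choose k * ((1 - p) / p / 2 ^ r)) :=
      hmode.trans (by gcongr)
    calc p / (1 - p) * 2 ^ r = p / (1 - p) * 2 ^ r * 1 := by ring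
      _ ≤ _ := mul_le_mul_of_nonneg_left h (by positivity)
      _ = _ := by field_simp
  · have hA : p / (1 - p) ≤ 1 := by rw [div_le_one hq]; linarith
    have h1 : p / (1 - p) * 2 ^ r / (2 * r + 1) ≤ 2 ^ r := by
      rw [div_le_iff₀ (by positivity)]
      have : p / (1 - p) * 2 ^ r ≤ 1 * 2 ^ r := by gcongr
      nlinarith [(by positivity : (0 : ℝ) ≤ 2 ^ r * (2 * r))]
    have h2 : (1 : ℝ) ≤ 2 ^ r := one_le_pow₀ one_le_two
    rw [Nat.cast_sub Nat.one_le_two_pow]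
    push_cast
    rw [pow_succ]
    linarith

lemma one_div_two_pow_le_sin (r : ℕ) : 1 / 2 ^ (r + 1) ≤ Real.sin (Real.pi / 2 ^ (r + 2)) := by
  have hpi := Real.pi_pos
  refine le_trans (le_of_eq ?_) (Real.mul_le_sin (by positivity) ?_)
  · field_simp
    ring
  · refine div_le_div_of_nonneg_left hpi.le two_pos ?_
    have h : (1 : ℝ) ≤ 2 ^ r := one_le_pow₀ one_le_two
    rw [pow_add]
    linarith

/-- for ε above the threshold ε*, the lower bound on the output bias
sin²(π/2^{r+2})·(p₋^{2r} + ‖B_{2r}‖_{2^{r+1}−1})/(2p₋^{2r}) tends to ∞, so it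
eventually exceeds ε and no randomness amplification is possible. -/
theorem no_amplification_above_threshold
    (c ε : ℝ) (hc : c ∈ Set.Ioo (0 : ℝ) 1) (hcH : binEnt (c / 2) = 1/2)
    (hεs : ((2 : ℝ) ^ (1 / (2 - c)) - 1) / (2 * ((2 : ℝ) ^ (1 / (2 - c)) + 1)) < ε)
    (hε : ε < 1/2) :
    Filter.Tendsto
      (fun r : ℕ => Real.sin (Real.pi / 2 ^ (r + 2)) ^ 2 *
        ((1/2 - ε) ^ (2 * r) + kyFan (2 ^ (r + 1) - 1) (bern (2 * r) ε)) /
        (2 * (1/2 - ε) ^ (2 * r)))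
      Filter.atTop Filter.atTop ∧
    ∃ r₀ : ℕ, ∀ r ≥ r₀,
      ε < Real.sin (Real.pi / 2 ^ (r + 2)) ^ 2 *
        ((1/2 - ε) ^ (2 * r) + kyFan (2 ^ (r + 1) - 1) (bern (2 * r) ε)) /
        (2 * (1/2 - ε) ^ (2 * r)) := by
  have hpos : 0 < c / 2 := by linarith [hc.1]
  have hle : c / 2 ≤ 1 / 2 := by linarith [hc.2]
  have hc2 : 0 < 2 - c := by linarith [hc.2]
  set t : ℝ := (2 : ℝ) ^ (1 / (2 - c)) with ht
  have ht1 : 1 < t := Real.one_lt_rpow one_lt_two (by positivity)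
  have hε0 : 0 ≤ ε := (div_nonneg (by linarith) (by linarith)).trans hεs.le
  have hm : 0 < 1 / 2 - ε := by linarith
  have hodds := lt_odds_of_lt (by linarith) hεs hε
  have hkf := le_kyFan_bern hpos hle hcH hε0 hε
  set q : ℝ := (1 / 2 + ε) / (1 / 2 - ε)
  have hq0 : 0 < q := by linarith
  have hρ : 2 < q ^ (2 * (1 - c / 2)) := by
    calc (2 : ℝ) = t ^ (2 - c) := by
          rw [ht, ← Real.rpow_mul zero_le_two, one_div_mul_cancel hc2.ne', Real.rpow_one]
      _ < q ^ (2 - c) := Real.rpow_lt_rpow (by linarith) hodds hc2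
      _ = _ := by congr 1; ring
  set ρ : ℝ := q ^ (2 * (1 - c / 2))
  have hA : 0 < c / 2 / (1 - c / 2) := div_pos hpos (by linarith)
  set A : ℝ := c / 2 / (1 - c / 2)
  have key : Filter.Tendsto
      (fun r : ℕ => Real.sin (Real.pi / 2 ^ (r + 2)) ^ 2 *
        ((1/2 - ε) ^ (2 * r) + kyFan (2 ^ (r + 1) - 1) (bern (2 * r) ε)) /
        (2 * (1/2 - ε) ^ (2 * r)))
      Filter.atTop Filter.atTop := by
    refine Filter.tendsto_atTop_mono (fun r => ?_)
      (tendsto_pow_div_linear_atTop (a := ρ / 2) (C := A / (8 * q)) (by linarith) (by positivity))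
    have hM : 0 < (1 / 2 - ε) ^ (2 * r) := by positivity
    have hsin := one_div_two_pow_le_sin r
    rw [le_div_iff₀ (by positivity)]
    calc A / (8 * q) * ((ρ / 2) ^ r / (2 * r + 1)) * (2 * (1 / 2 - ε) ^ (2 * r))
        = (1 / 2 ^ (r + 1)) ^ 2 *
          (A * 2 ^ r / (2 * r + 1) * ((1 / 2 - ε) ^ (2 * r) * (ρ ^ r / q))) := by
          rw [div_pow]
          field_simp
          ring
      _ ≤ (1 / 2 ^ (r + 1)) ^ 2 * kyFan (2 ^ (r + 1) - 1) (bern (2 * r) ε) := by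
          gcongr
          exact hkf r
      _ ≤ Real.sin (Real.pi / 2 ^ (r + 2)) ^ 2 *
          ((1/2 - ε) ^ (2 * r) + kyFan (2 ^ (r + 1) - 1) (bern (2 * r) ε)) := by
          have := (hkf r).trans' (by positivity)
          gcongr
          linarith
  exact ⟨key, Filter.eventually_atTop.1 (key.eventually_gt_atTop ε)⟩
end
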